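/- In the bipartite random clustering setup, with probability at least 99/100 the following holds: for all but at most exp(−Cε²/32)·m' indices i ∈ [2, m'], there are at least (1 − 2·exp(−Cε²/16))·n² subsets T ⊆ V(G) with |T ∩ V_j| ≤ 1 for each j ∈ [2] such that δ_{1}(G[D_i ∪ T]) + δ_{2}(G[D_i ∪ T]) ≥ (1 + ε/2)·C. -/

import Mathlib

/-- Index of the interval containing `x` (1-based): `W_1 = [0, r)`, and for `i ≥ 2`,
`W_i` is the `(i-1)`-st interval of length `w` after that. -/
def clusterIndex (r w x : ℕ) : ℕ := if x < r then 1 else (x - r) / w + 2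

open Classical in
/-- Uniform probability, over a pair of independent uniformly random permutations,
of the event `E`. -/
noncomputable def permProb (N M : ℕ)
    (E : Equiv.Perm (Fin N) × Equiv.Perm (Fin M) → Prop) : ℝ :=
  (((Finset.univ : Finset (Equiv.Perm (Fin N) × Equiv.Perm (Fin M))).filter E).card : ℝ) /
    ((Finset.univ : Finset (Equiv.Perm (Fin N) × Equiv.Perm (Fin M))).card : ℝ)

/-- One side of the `i`-th random cluster `D_i`: the set of `j` with `π j` in the `i`-th
interval, where the first interval has length `r = (C-1)C + (n mod (C-1)C)` and the later
ones length `C-1`. -/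
def bipCluster (n C i : ℕ) (π : Equiv.Perm (Fin n)) : Finset (Fin n) :=
  Finset.univ.filter fun v =>
    clusterIndex ((C - 1) * C + n % ((C - 1) * C)) (C - 1) (π v).val = i

/-- The number `m'` of clusters. -/
def numClustersBip (n C : ℕ) : ℕ :=
  (n - ((C - 1) * C + n % ((C - 1) * C))) / (C - 1) + 1

open Classical in
/-- The number of sets `T ⊆ V(G)` with `|T ∩ V_j| ≤ 1` for `j ∈ [2]` (encoded as pairs
`(T₁, T₂)`) for which the cluster `D_i ∪ T` inherits the degree condition. -/
noncomputable def numGoodT (n C : ℕ) (ε : ℝ) (Adj : Fin n → Fin n → Prop) (i : ℕ)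
    (π : Equiv.Perm (Fin n) × Equiv.Perm (Fin n)) : ℕ :=
  (((Finset.univ : Finset (Fin n)).powerset ×ˢ (Finset.univ : Finset (Fin n)).powerset).filter
    fun T => T.1.card ≤ 1 ∧ T.2.card ≤ 1 ∧
      ∀ v ∈ bipCluster n C i π.1 ∪ T.1, ∀ u ∈ bipCluster n C i π.2 ∪ T.2,
        (1 + ε / 2) * (C : ℝ) ≤
          (((bipCluster n C i π.2 ∪ T.2).filter fun b => Adj v b).card : ℝ) +
            (((bipCluster n C i π.1 ∪ T.1).filter fun a => Adj a u).card : ℝ)).card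

open Finset in
/-- At most `(n - K)!` permutations of `Fin n` have prescribed values at `K` distinct points. -/
theorem card_perm_comp_eq_le {K n : ℕ} {w : Fin K → Fin n} (hw : Function.Injective w)
    (x : Fin K → Fin n) :
    #{σ : Equiv.Perm (Fin n) | σ ∘ w = x} ≤ (n - K).factorial := by
  classical
  rcases Finset.eq_empty_or_nonempty
    ({σ : Equiv.Perm (Fin n) | σ ∘ w = x} : Finset (Equiv.Perm (Fin n))) with h | ⟨σ₀, h₀⟩
  · simp [h]
  simp only [Finset.mem_filter, Finset.mem_univ, true_and] at h₀
  have hcard : Fintype.card {f : Equiv.Perm (Fin n) // ∀ a, ¬ (a ∉ Set.range w) → f a = a}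
      = (n - K).factorial := by
    rw [← Fintype.card_congr (Equiv.Perm.subtypeEquivSubtypePerm fun a => a ∉ Set.range w),
      Fintype.card_perm, Fintype.card_subtype_compl]
    congr 2
    · simp
    · exact (Set.card_range_of_injective hw).trans (Fintype.card_fin K)
  rw [← hcard, Fintype.card_subtype]
  refine Finset.card_le_card_of_injOn (fun σ => σ₀⁻¹ * σ) ?_ (fun _ _ _ _ h => by simpa using h)
  intro σ hσ
  simp only [Finset.coe_filter, Finset.mem_univ, true_and, Set.mem_ofPred_eq, not_not,
    Set.forall_mem_range] at hσ ⊢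
  intro j
  have h : σ (w j) = σ₀ (w j) := (congrFun hσ j).trans (congrFun h₀ j).symm
  simp [h]

theorem sum_perm_comp_le {K n : ℕ} {w : Fin K → Fin n} (hw : Function.Injective w)
    (f : (Fin K → Fin n) → ℕ) :
    ∑ σ : Equiv.Perm (Fin n), f (σ.symm ∘ w) ≤ (n - K).factorial * ∑ x, f x := by
  classical
  rw [show ∑ σ : Equiv.Perm (Fin n), f (σ.symm ∘ w) = ∑ σ : Equiv.Perm (Fin n), f (σ ∘ w) from
      Equiv.sum_comp (Equiv.inv (Equiv.Perm (Fin n))) fun σ => f (σ ∘ w),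
    Finset.sum_comp f fun σ : Equiv.Perm (Fin n) => (σ ∘ w : Fin K → Fin n), Finset.mul_sum]
  refine (Finset.sum_le_sum fun x _ => ?_).trans
    (Finset.sum_le_sum_of_subset (Finset.subset_univ _))
  exact Nat.mul_le_mul_right _ (card_perm_comp_eq_le hw x)

theorem sum_perm_prod_comp_le {K n : ℕ} {w : Fin K → Fin n} (hw : Function.Injective w)
    (f : (Fin K → Fin n) → (Fin K → Fin n) → ℕ) :
    ∑ π : Equiv.Perm (Fin n) × Equiv.Perm (Fin n), f (π.1.symm ∘ w) (π.2.symm ∘ w) ≤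
      (n - K).factorial ^ 2 * ∑ x, ∑ y, f x y := by
  rw [Fintype.sum_prod_type]
  calc ∑ σ : Equiv.Perm (Fin n), ∑ τ : Equiv.Perm (Fin n), f (σ.symm ∘ w) (τ.symm ∘ w)
      ≤ ∑ σ : Equiv.Perm (Fin n), (n - K).factorial * ∑ y, f (σ.symm ∘ w) y :=
        Finset.sum_le_sum fun σ _ => sum_perm_comp_le hw _
    _ ≤ (n - K).factorial * ((n - K).factorial * ∑ x, ∑ y, f x y) := by
        rw [← Finset.mul_sum]
        exact Nat.mul_le_mul_left _ (sum_perm_comp_le hw fun x => ∑ y, f x y)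
    _ = _ := by ring

theorem pow_mul_factorial_sub_le {K n : ℕ} (hn : 2 * K ^ 2 ≤ n) (hn0 : 0 < n) :
    n ^ K * (n - K).factorial ≤ 2 * n.factorial := by
  have hK : K ≤ n := by nlinarith
  rw [← Nat.factorial_mul_descFactorial hK]
  have key : n ^ K ≤ 2 * n.descFactorial K := by
    have h1 : (n - K) ^ K ≤ n.descFactorial K :=
      (Nat.pow_le_pow_left (by omega) K).trans (Nat.pow_sub_le_descFactorial n K)
    have hn' : (0 : ℝ) < n := by exact_mod_cast hn0
    have h2 : (1 : ℝ) / 2 ≤ (1 + -(K / n : ℝ)) ^ K := by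
      have hKn : (K : ℝ) / n ≤ 1 := by
        rw [div_le_one hn']; exact_mod_cast hK
      refine le_trans ?_ (one_add_mul_le_pow (by linarith) K)
      have : (K : ℝ) * (K / n) ≤ 1 / 2 := by
        rw [← mul_div_assoc, div_le_iff₀ hn']
        have : (2 * K ^ 2 : ℝ) ≤ n := by exact_mod_cast hn
        nlinarith
      linarith
    have h3 : (n : ℝ) ^ K ≤ 2 * ((n - K : ℕ) : ℝ) ^ K := by
      have : ((n - K : ℕ) : ℝ) = n * (1 + -(K / n : ℝ)) := by
        rw [Nat.cast_sub hK]; field_simp; ring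
      rw [this, mul_pow]
      nlinarith [pow_pos hn' K]
    have h4 : n ^ K ≤ 2 * (n - K) ^ K := by exact_mod_cast h3
    omega
  calc n ^ K * (n - K).factorial ≤ 2 * n.descFactorial K * (n - K).factorial :=
        Nat.mul_le_mul_right _ key
    _ = _ := by ring

open Finset in
/-- Moment generating function of the number of independent uniform samples satisfying `P`. -/
theorem sum_exp_card_le {K n : ℕ} (hn : 0 < n) (P : Fin n → Prop)
    [DecidablePred P] (l : ℝ) :
    ∑ Y : Fin K → Fin n, Real.exp (l * #{j | P (Y j)}) ≤
      (n : ℝ) ^ K * Real.exp (K * ((#{b | P b} : ℝ) / n * (Real.exp l - 1))) := by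
  have hn' : (0 : ℝ) < n := by exact_mod_cast hn
  have h1 : ∀ Y : Fin K → Fin n, Real.exp (l * #{j | P (Y j)}) =
      ∏ j, (if P (Y j) then Real.exp l else 1) := by
    intro Y
    rw [Finset.prod_ite, Finset.prod_const, Finset.prod_const_one, mul_one, ← Real.exp_nat_mul,
      mul_comm]
  simp_rw [h1]
  rw [← Fintype.sum_pow (fun b => if P b then Real.exp l else 1) K, Real.exp_nat_mul, ← mul_pow]
  refine pow_le_pow_left₀ (Finset.sum_nonneg fun b _ => by split_ifs <;> positivity) ?_ K
  have h2 : ∑ b : Fin n, (if P b then Real.exp l else 1) =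
      n * ((#{b | P b} : ℝ) / n * (Real.exp l - 1) + 1) := by
    have : ∀ b : Fin n, (if P b then Real.exp l else 1) =
        (if P b then (Real.exp l - 1) else 0) + 1 := by
      intro b; split_ifs <;> ring
    simp_rw [this]
    rw [Finset.sum_add_distrib, ← Finset.sum_filter]
    simp
    field_simp
  rw [h2]
  exact mul_le_mul_of_nonneg_left (Real.add_one_le_exp _) hn'.le

open Finset in
theorem card_filter_insertNth_le {K : ℕ} {α : Type*} (P : α → Prop) [DecidablePred P] (s : Fin (K + 1)) (v : α)
    (X : Fin K → α) :
    #{j | P ((s.insertNth v X : Fin (K + 1) → α) j)} ≤ 1 + #{j | P (X j)} := by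
  simp only [Finset.card_filter]
  rw [Fin.sum_univ_succAbove _ s]
  simp only [Fin.insertNth_apply_same, Fin.insertNth_apply_succAbove]
  gcongr
  split_ifs <;> simp

theorem sum_insertNth {K : ℕ} {α M : Type*} [Fintype α] [AddCommMonoid M] (s : Fin (K + 1))
    (f : (Fin (K + 1) → α) → M) :
    ∑ X, f X = ∑ v, ∑ X : Fin K → α, f (s.insertNth v X) := by
  rw [← Fintype.sum_prod_type']
  exact (Equiv.sum_comp (Fin.insertNthEquiv (fun _ => α) s) f).symm

open Classical Finset in
theorem sum_exp_nonadj_le {K n : ℕ} (hn : 0 < n) {Adj : Fin n → Fin n → Prop} {ε l : ℝ}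
    (hl : 0 ≤ l)
    (hAdj : ∀ a b : Fin n, (1 + ε) * n ≤ (#{b' | Adj a b'} : ℝ) + #{a' | Adj a' b})
    (s t : Fin (K + 1)) :
    ∑ X : Fin (K + 1) → Fin n, ∑ Y : Fin (K + 1) → Fin n,
        Real.exp (l * ((#{j | ¬ Adj (X s) (Y j)} : ℝ) + #{j | ¬ Adj (X j) (Y t)})) ≤
      ((n : ℝ) ^ (K + 1)) ^ 2 * Real.exp (2 * l + K * ((1 - ε) * (Real.exp l - 1))) := by
  have hn' : (0 : ℝ) < n := by exact_mod_cast hn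
  have hel : 0 ≤ Real.exp l - 1 := by linarith [Real.add_one_le_exp l]
  rw [sum_insertNth s]
  have hv : ∀ v u : Fin n, ∑ X : Fin K → Fin n, ∑ Y : Fin K → Fin n,
      Real.exp (l * ((#{j | ¬ Adj v ((t.insertNth u Y : Fin (K + 1) → Fin n) j)} : ℝ) +
        #{j | ¬ Adj ((s.insertNth v X : Fin (K + 1) → Fin n) j) u})) ≤
      ((n : ℝ) ^ K) ^ 2 * Real.exp (2 * l + K * ((1 - ε) * (Real.exp l - 1))) := by
    intro v u
    calc _ ≤ ∑ X : Fin K → Fin n, ∑ Y : Fin K → Fin n, Real.exp (2 * l) *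
          (Real.exp (l * #{j | ¬ Adj v (Y j)}) * Real.exp (l * #{j | ¬ Adj (X j) u})) := by
          refine Finset.sum_le_sum fun X _ => Finset.sum_le_sum fun Y _ => ?_
          rw [← Real.exp_add, ← Real.exp_add, Real.exp_le_exp]
          have h1 : (#{j | ¬ Adj v ((t.insertNth u Y : Fin (K + 1) → Fin n) j)} : ℝ) ≤
              1 + #{j | ¬ Adj v (Y j)} := by
            exact_mod_cast card_filter_insertNth_le (fun b => ¬ Adj v b) t u Y
          have h2 : (#{j | ¬ Adj ((s.insertNth v X : Fin (K + 1) → Fin n) j) u} : ℝ) ≤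
              1 + #{j | ¬ Adj (X j) u} := by
            exact_mod_cast card_filter_insertNth_le (fun a => ¬ Adj a u) s v X
          nlinarith
      _ = Real.exp (2 * l) * ((∑ Y : Fin K → Fin n, Real.exp (l * #{j | ¬ Adj v (Y j)})) *
          ∑ X : Fin K → Fin n, Real.exp (l * #{j | ¬ Adj (X j) u})) := by
          simp_rw [← Finset.mul_sum, ← Finset.sum_mul, ← Finset.mul_sum]
      _ ≤ Real.exp (2 * l) *
          (((n : ℝ) ^ K * Real.exp (K * ((#{b | ¬ Adj v b} : ℝ) / n * (Real.exp l - 1)))) *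
          ((n : ℝ) ^ K * Real.exp (K * ((#{a | ¬ Adj a u} : ℝ) / n * (Real.exp l - 1))))) := by
          gcongr
          · exact sum_exp_card_le hn (fun b => ¬ Adj v b) l
          · exact sum_exp_card_le hn (fun a => ¬ Adj a u) l
      _ = ((n : ℝ) ^ K) ^ 2 * Real.exp (2 * l + K * ((((#{b | ¬ Adj v b} : ℝ) +
          #{a | ¬ Adj a u}) / n) * (Real.exp l - 1))) := by
          rw [add_div, add_mul, mul_add, Real.exp_add, Real.exp_add]
          ring
      _ ≤ _ := by
          have h1 : (#{b | Adj v b} : ℝ) + #{b | ¬ Adj v b} = n := by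
            have := Finset.card_filter_add_card_filter_not (s := (univ : Finset (Fin n)))
              (fun b => Adj v b)
            rw [Finset.card_univ, Fintype.card_fin] at this
            exact_mod_cast this
          have h2 : (#{a | Adj a u} : ℝ) + #{a | ¬ Adj a u} = n := by
            have := Finset.card_filter_add_card_filter_not (s := (univ : Finset (Fin n)))
              (fun a => Adj a u)
            rw [Finset.card_univ, Fintype.card_fin] at this
            exact_mod_cast this
          gcongr
          rw [div_le_iff₀ hn']
          linarith [hAdj v u]
  calc _ = ∑ v : Fin n, ∑ u : Fin n, ∑ X : Fin K → Fin n, ∑ Y : Fin K → Fin n,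
      Real.exp (l * ((#{j | ¬ Adj v ((t.insertNth u Y : Fin (K + 1) → Fin n) j)} : ℝ) +
        #{j | ¬ Adj ((s.insertNth v X : Fin (K + 1) → Fin n) j) u})) := by
        refine Finset.sum_congr rfl fun v _ => ?_
        refine (Finset.sum_congr rfl fun X _ => sum_insertNth t _).trans ?_
        rw [Finset.sum_comm]
        simp only [Fin.insertNth_apply_same]
    _ ≤ ∑ v : Fin n, ∑ u : Fin n,
        ((n : ℝ) ^ K) ^ 2 * Real.exp (2 * l + K * ((1 - ε) * (Real.exp l - 1))) :=
        Finset.sum_le_sum fun v _ => Finset.sum_le_sum fun u _ => hv v u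
    _ = _ := by
        simp only [Finset.sum_const, Finset.card_univ, Fintype.card_fin, nsmul_eq_mul]
        ring

open Finset in
open Classical in
/-- Some vertex of `X` and some vertex of `Y` have degree sum below `c` between the tuples `X`
and `Y`, counted with multiplicity. -/
def HasSparsePair {k n : ℕ} (Adj : Fin n → Fin n → Prop) (c : ℝ) (X Y : Fin k → Fin n) : Prop :=
  ∃ s t, (#{j | Adj (X s) (Y j)} : ℝ) + #{j | Adj (X j) (Y t)} < c

theorem exp_half_exponent_le {ε : ℝ} (hε : 0 < ε) (hε1 : ε ≤ 1) {K : ℕ} :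
    2 * (ε / 2) + K * ((1 - ε) * (Real.exp (ε / 2) - 1)) - ε / 2 * ((1 - ε / 2) * (K + 1)) ≤
      1 - (K + 1) * ε ^ 2 / 8 := by
  have h := Real.exp_bound' (x := ε / 2) (by linarith) (by linarith) (n := 3) (by norm_num)
  norm_num [Finset.sum_range_succ, Nat.factorial] at h
  have h1 : (1 - ε) * (Real.exp (ε / 2) - 1) ≤ ε / 2 * (1 - ε / 2) - ε ^ 2 / 8 := by
    have h2 : Real.exp (ε / 2) - 1 ≤ ε / 2 + ε ^ 2 / 8 + ε ^ 3 / 8 := by nlinarith [pow_pos hε 3]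
    refine (mul_le_mul_of_nonneg_left h2 (by linarith)).trans ?_
    nlinarith [pow_pos hε 3, pow_pos hε 4]
  have h3 := mul_le_mul_of_nonneg_left h1 (Nat.cast_nonneg (α := ℝ) K)
  nlinarith

open Classical Finset in
theorem card_hasSparsePair_le {K n : ℕ} (hn : 0 < n) {Adj : Fin n → Fin n → Prop} {ε : ℝ}
    (hε : 0 < ε) (hε1 : ε ≤ 1)
    (hAdj : ∀ a b : Fin n, (1 + ε) * n ≤ (#{b' | Adj a b'} : ℝ) + #{a' | Adj a' b}) :
    (#{Z : (Fin (K + 1) → Fin n) × (Fin (K + 1) → Fin n) |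
        HasSparsePair Adj ((1 + ε / 2) * (K + 1)) Z.1 Z.2} : ℝ) ≤
      ((n : ℝ) ^ (K + 1)) ^ 2 * ((K + 1) ^ 2 * (3 * Real.exp (-((K + 1) * ε ^ 2 / 8)))) := by
  set Q : Fin (K + 1) → Fin (K + 1) → (Fin (K + 1) → Fin n) × (Fin (K + 1) → Fin n) → ℝ :=
    fun s t Z => (#{j | ¬ Adj (Z.1 s) (Z.2 j)} : ℝ) + #{j | ¬ Adj (Z.1 j) (Z.2 t)} with hQ
  set c : ℝ := (1 - ε / 2) * (K + 1) with hc
  have hpt : ∀ Z : (Fin (K + 1) → Fin n) × (Fin (K + 1) → Fin n),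
      (if HasSparsePair Adj ((1 + ε / 2) * (K + 1)) Z.1 Z.2 then (1 : ℝ) else 0) ≤
        ∑ s, ∑ t, Real.exp (ε / 2 * Q s t Z - ε / 2 * c) := by
    intro Z
    split_ifs with h
    · obtain ⟨s, t, hst⟩ := h
      have h1 : (#{j | Adj (Z.1 s) (Z.2 j)} : ℝ) + #{j | ¬ Adj (Z.1 s) (Z.2 j)} = K + 1 := by
        have := Finset.card_filter_add_card_filter_not (s := (univ : Finset (Fin (K + 1))))
          (fun j => Adj (Z.1 s) (Z.2 j))
        rw [Finset.card_univ, Fintype.card_fin] at this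
        exact_mod_cast this
      have h2 : (#{j | Adj (Z.1 j) (Z.2 t)} : ℝ) + #{j | ¬ Adj (Z.1 j) (Z.2 t)} = K + 1 := by
        have := Finset.card_filter_add_card_filter_not (s := (univ : Finset (Fin (K + 1))))
          (fun j => Adj (Z.1 j) (Z.2 t))
        rw [Finset.card_univ, Fintype.card_fin] at this
        exact_mod_cast this
      have h3 : c ≤ Q s t Z := by
        simp only [hQ, hc]; linarith
      have h4 : (1 : ℝ) ≤ Real.exp (ε / 2 * Q s t Z - ε / 2 * c) :=
        Real.one_le_exp (by nlinarith)
      refine h4.trans ?_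
      refine le_trans ?_ (Finset.single_le_sum
        (f := fun s => ∑ t, Real.exp (ε / 2 * Q s t Z - ε / 2 * c))
        (fun s _ => Finset.sum_nonneg fun t _ => (Real.exp_pos _).le) (Finset.mem_univ s))
      exact Finset.single_le_sum (f := fun t => Real.exp (ε / 2 * Q s t Z - ε / 2 * c))
        (fun t _ => (Real.exp_pos _).le) (Finset.mem_univ t)
    · positivity
  have hst : ∀ s t, ∑ Z, Real.exp (ε / 2 * Q s t Z - ε / 2 * c) ≤
      ((n : ℝ) ^ (K + 1)) ^ 2 * (3 * Real.exp (-((K + 1) * ε ^ 2 / 8))) := by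
    intro s t
    have h := sum_exp_nonadj_le (K := K) hn (l := ε / 2) (by linarith) hAdj s t
    simp_rw [Real.exp_sub, ← Finset.sum_div]
    rw [Fintype.sum_prod_type, div_le_iff₀ (Real.exp_pos _)]
    refine h.trans ?_
    rw [mul_assoc]
    refine mul_le_mul_of_nonneg_left ?_ (by positivity)
    rw [← div_le_iff₀ (Real.exp_pos _), ← Real.exp_sub]
    refine (Real.exp_le_exp.2 (exp_half_exponent_le hε hε1)).trans ?_
    rw [sub_eq_add_neg, Real.exp_add]
    gcongr
    exact Real.exp_one_lt_three.le
  calc _ = ∑ Z : (Fin (K + 1) → Fin n) × (Fin (K + 1) → Fin n),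
        (if HasSparsePair Adj ((1 + ε / 2) * (K + 1)) Z.1 Z.2 then (1 : ℝ) else 0) := by
        rw [Finset.sum_boole]
    _ ≤ ∑ Z, ∑ s, ∑ t, Real.exp (ε / 2 * Q s t Z - ε / 2 * c) :=
        Finset.sum_le_sum fun Z _ => hpt Z
    _ = ∑ s, ∑ t, ∑ Z, Real.exp (ε / 2 * Q s t Z - ε / 2 * c) := by
        rw [Finset.sum_comm]
        exact Finset.sum_congr rfl fun s _ => Finset.sum_comm
    _ ≤ ∑ s : Fin (K + 1), ∑ t : Fin (K + 1),
        ((n : ℝ) ^ (K + 1)) ^ 2 * (3 * Real.exp (-((K + 1) * ε ^ 2 / 8))) :=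
        Finset.sum_le_sum fun s _ => Finset.sum_le_sum fun t _ => hst s t
    _ = _ := by
        simp only [Finset.sum_const, Finset.card_univ, Fintype.card_fin, nsmul_eq_mul]
        push_cast
        ring

open Classical Finset in
/-- The number of one-point extensions of the tuples `x` and `y` that have a sparse pair. -/
noncomputable def numSparseExtensions {K n : ℕ} (Adj : Fin n → Fin n → Prop) (c : ℝ)
    (x y : Fin K → Fin n) : ℕ :=
  #{p : Fin n × Fin n | HasSparsePair Adj c
    (Fin.insertNth 0 p.1 x : Fin (K + 1) → Fin n) (Fin.insertNth 0 p.2 y : Fin (K + 1) → Fin n)}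

open Classical Finset in
theorem sum_numSparseExtensions {K n : ℕ} (Adj : Fin n → Fin n → Prop) (c : ℝ) :
    ∑ x : Fin K → Fin n, ∑ y : Fin K → Fin n, numSparseExtensions Adj c x y =
      #{Z : (Fin (K + 1) → Fin n) × (Fin (K + 1) → Fin n) | HasSparsePair Adj c Z.1 Z.2} := by
  rw [Finset.card_filter, Fintype.sum_prod_type, sum_insertNth 0]
  symm
  rw [Finset.sum_comm]
  refine Finset.sum_congr rfl fun x _ => ?_
  simp only [numSparseExtensions, Finset.card_filter, Fintype.sum_prod_type]
  refine Eq.trans ?_ Finset.sum_comm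
  refine Finset.sum_congr rfl fun a _ => ?_
  rw [sum_insertNth 0, Finset.sum_comm]

open Finset in
theorem image_insertNth_zero {K n : ℕ} (a : Fin n) (x : Fin K → Fin n) :
    univ.image (Fin.insertNth 0 a x : Fin (K + 1) → Fin n) = univ.image x ∪ {a} := by
  ext v
  simp [Fin.exists_fin_succ, eq_comm]

theorem insertNth_zero_injective {K n : ℕ} {a : Fin n} {x : Fin K → Fin n}
    (hx : Function.Injective x) (ha : a ∉ Finset.univ.image x) :
    Function.Injective (Fin.insertNth 0 a x : Fin (K + 1) → Fin n) := by
  rw [Fin.insertNth_zero']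
  exact Fin.cons_injective_iff.2 ⟨by simpa using ha, hx⟩

open Classical Finset in
theorem sq_le_numGoodT_add {K n i : ℕ} {ε : ℝ} {Adj : Fin n → Fin n → Prop}
    {π : Equiv.Perm (Fin n) × Equiv.Perm (Fin n)} {x y : Fin K → Fin n}
    (hx : Function.Injective x) (hy : Function.Injective y)
    (hA : bipCluster n (K + 1) i π.1 = univ.image x)
    (hB : bipCluster n (K + 1) i π.2 = univ.image y) :
    n ^ 2 ≤ numGoodT n (K + 1) ε Adj i π + 2 * K * n +
      numSparseExtensions Adj ((1 + ε / 2) * (K + 1)) x y := by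
  set good : Finset (Fin n × Fin n) := {p | p.1 ∉ univ.image x ∧ p.2 ∉ univ.image y ∧
    ¬ HasSparsePair Adj ((1 + ε / 2) * (K + 1)) (Fin.insertNth 0 p.1 x : Fin (K + 1) → Fin n)
      (Fin.insertNth 0 p.2 y : Fin (K + 1) → Fin n)} with hgood
  have hcover : (univ : Finset (Fin n × Fin n)) ⊆
      ((good ∪ (univ.image x ×ˢ univ)) ∪ (univ ×ˢ univ.image y)) ∪
      ({p : Fin n × Fin n | HasSparsePair Adj ((1 + ε / 2) * (K + 1))
        (Fin.insertNth 0 p.1 x : Fin (K + 1) → Fin n)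
        (Fin.insertNth 0 p.2 y : Fin (K + 1) → Fin n)} : Finset (Fin n × Fin n)) := by
    intro p _
    simp only [hgood, Finset.mem_union, Finset.mem_product, Finset.mem_filter, Finset.mem_univ,
      true_and, and_true]
    tauto
  have h1 := (Finset.card_le_card hcover).trans ((Finset.card_union_le _ _).trans
    (Nat.add_le_add_right ((Finset.card_union_le _ _).trans
      (Nat.add_le_add_right (Finset.card_union_le _ _) _)) _))
  simp only [Finset.card_univ, Finset.card_product, Fintype.card_prod, Fintype.card_fin,
    Finset.card_image_of_injective _ hx, Finset.card_image_of_injective _ hy] at h1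
  have h2 : #good ≤ numGoodT n (K + 1) ε Adj i π := by
    refine Finset.card_le_card_of_injOn (fun p => ({p.1}, {p.2})) ?_ ?_
    · rintro ⟨a, b⟩ hp
      simp only [hgood, Finset.coe_filter, Set.mem_ofPred_eq, Finset.mem_univ, true_and] at hp
      obtain ⟨ha, hb, hs⟩ := hp
      simp only [Finset.coe_filter, Set.mem_ofPred_eq, hA, hB, ← image_insertNth_zero]
      refine ⟨by simp, by simp, by simp, ?_⟩
      intro v hv u hu
      obtain ⟨s, -, rfl⟩ := Finset.mem_image.1 hv
      obtain ⟨t, -, rfl⟩ := Finset.mem_image.1 hu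
      rw [Finset.filter_image, Finset.filter_image,
        Finset.card_image_of_injective _ (insertNth_zero_injective hx ha),
        Finset.card_image_of_injective _ (insertNth_zero_injective hy hb)]
      simp only [HasSparsePair, not_exists, not_lt] at hs
      push_cast
      exact hs s t
    · rintro ⟨a, b⟩ _ ⟨a', b'⟩ _ h
      simpa using h
  unfold numSparseExtensions
  nlinarith

theorem bipCluster_eq_image {K n i : ℕ} (hK : 0 < K)
    (hi : i ∈ Finset.Icc 2 (numClustersBip n (K + 1))) :
    ∃ w : Fin K → Fin n, Function.Injective w ∧
      ∀ π : Equiv.Perm (Fin n), bipCluster n (K + 1) i π = Finset.univ.image (π.symm ∘ w) := by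
  obtain ⟨hi2, him⟩ := Finset.mem_Icc.1 hi
  obtain ⟨q, rfl⟩ := Nat.exists_eq_add_of_le' hi2
  unfold numClustersBip at him
  unfold bipCluster clusterIndex
  simp only [Nat.add_sub_cancel] at him ⊢
  set r := K * (K + 1) + n % (K * (K + 1))
  have hqK : (q + 1) * K ≤ n - r := by
    have h := Nat.div_mul_le_self (n - r) K
    have : q + 1 ≤ (n - r) / K := by omega
    exact (Nat.mul_le_mul_right K this).trans h
  have hlt : ∀ j : Fin K, r + q * K + j < n := by
    intro j
    have := j.2
    rw [add_mul] at hqK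
    omega
  refine ⟨fun j => ⟨r + q * K + j, hlt j⟩, ?_, ?_⟩
  · intro j j' h
    simp only [Fin.mk.injEq] at h
    exact Fin.ext (by omega)
  · intro π
    ext v
    simp only [Finset.mem_filter, Finset.mem_univ, true_and, Finset.mem_image, Function.comp_apply,
      Equiv.symm_apply_eq]
    constructor
    · intro h
      split_ifs at h with hr
      · omega
      have hd : ((π v).val - r) / K = q := by omega
      refine ⟨⟨((π v).val - r) % K, Nat.mod_lt _ hK⟩, Fin.ext ?_⟩
      have := Nat.div_add_mod ((π v).val - r) K
      rw [hd, mul_comm] at this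
      simp only
      omega
    · rintro ⟨j, hj⟩
      have hv : (π v).val = r + q * K + j := by rw [← hj]
      rw [hv, if_neg (by omega)]
      have : r + q * K + (j : ℕ) - r = j + K * q := by rw [mul_comm K]; omega
      rw [this, Nat.add_mul_div_left _ _ hK, Nat.div_eq_of_lt j.2]
      omega

open Classical Finset in
/-- Markov bound for the number of bad indices, each of which is bad with probability at most `p`. -/
theorem permProb_ge_of_card_bad_le {N m : ℕ} {s : Finset ℕ} (hs : #s ≤ m) (hm : 0 < m)
    {bad : ℕ → Equiv.Perm (Fin N) × Equiv.Perm (Fin N) → Prop} [∀ i π, Decidable (bad i π)] {p θ : ℝ} (hθ : 0 < θ)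
    (hp : p ≤ θ / 100) (hp0 : 0 ≤ p)
    (h : ∀ i ∈ s, (#{π | bad i π} : ℝ) ≤ p * (N.factorial : ℝ) ^ 2) :
    (99 : ℝ) / 100 ≤ permProb N N fun π => (#{i ∈ s | bad i π} : ℝ) ≤ θ * m := by
  have hm' : (0 : ℝ) < m := by exact_mod_cast hm
  have hN : (0 : ℝ) < (N.factorial : ℝ) ^ 2 := by positivity
  have htot : (#(univ : Finset (Equiv.Perm (Fin N) × Equiv.Perm (Fin N))) : ℝ) =
      (N.factorial : ℝ) ^ 2 := by
    rw [Finset.card_univ, Fintype.card_prod, Fintype.card_perm, Fintype.card_fin]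
    push_cast
    ring
  set E : Equiv.Perm (Fin N) × Equiv.Perm (Fin N) → Prop :=
    fun π => (#{i ∈ s | bad i π} : ℝ) ≤ θ * m with hE
  have h1 : (#{π | E π} : ℝ) + #{π | ¬ E π} = (N.factorial : ℝ) ^ 2 := by
    rw [← htot, ← Finset.card_filter_add_card_filter_not
      (s := (univ : Finset (Equiv.Perm (Fin N) × Equiv.Perm (Fin N)))) E]
    push_cast
    rfl
  have h2 : (#{π | ¬ E π} : ℝ) * (θ * m) ≤ m * (p * (N.factorial : ℝ) ^ 2) := by
    calc (#{π | ¬ E π} : ℝ) * (θ * m) = ∑ π with ¬ E π, θ * m := by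
          rw [Finset.sum_const, nsmul_eq_mul]
      _ ≤ ∑ π with ¬ E π, (#{i ∈ s | bad i π} : ℝ) :=
          Finset.sum_le_sum fun π hπ => (not_le.1 (Finset.mem_filter.1 hπ).2).le
      _ ≤ ∑ π, (#{i ∈ s | bad i π} : ℝ) :=
          Finset.sum_le_sum_of_subset_of_nonneg (Finset.filter_subset _ _)
            fun _ _ _ => Nat.cast_nonneg _
      _ = ∑ i ∈ s, (#{π | bad i π} : ℝ) := by
          simp only [← Finset.sum_boole]
          exact Finset.sum_comm
      _ ≤ ∑ i ∈ s, p * (N.factorial : ℝ) ^ 2 := Finset.sum_le_sum h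
      _ ≤ m * (p * (N.factorial : ℝ) ^ 2) := by
          rw [Finset.sum_const, nsmul_eq_mul]
          gcongr
  have h3 : (#{π | ¬ E π} : ℝ) ≤ (N.factorial : ℝ) ^ 2 / 100 := by
    have h4 : m * (p * (N.factorial : ℝ) ^ 2) ≤ ((N.factorial : ℝ) ^ 2 / 100) * (θ * m) := by
      have := mul_le_mul_of_nonneg_right hp (mul_pos hm' hN).le
      nlinarith
    exact le_of_mul_le_mul_right (h2.trans h4) (by positivity)
  unfold permProb
  rw [htot, le_div_iff₀ hN]
  linarith

theorem exists_forall_sq_mul_exp_le {ε : ℝ} (hε : 0 < ε) :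
    ∃ C₀ : ℕ, ∀ C : ℕ, C₀ ≤ C → 1200 * (C : ℝ) ^ 2 * Real.exp (-(C * ε ^ 2 / 32)) ≤ 1 := by
  have h1 := (Real.tendsto_pow_mul_exp_neg_atTop_nhds_zero 2).comp
    ((tendsto_natCast_atTop_atTop (R := ℝ)).atTop_mul_const (show 0 < ε ^ 2 / 32 by positivity))
  have hc : (0 : ℝ) < (ε ^ 2 / 32) ^ 2 / 1200 := by positivity
  obtain ⟨C₀, hC₀⟩ := Filter.eventually_atTop.1 (h1.eventually (gt_mem_nhds hc))
  refine ⟨C₀, fun C hC => ?_⟩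
  have h2 := hC₀ C hC
  simp only [Function.comp_apply, mul_pow] at h2
  rw [show -((C : ℝ) * ε ^ 2 / 32) = -(C * (ε ^ 2 / 32)) by ring]
  have h3 : (0 : ℝ) < (ε ^ 2 / 32) ^ 2 := by positivity
  rw [← mul_le_mul_iff_left₀ h3]
  linarith

open Classical Finset in
/-- The proportion of permutation pairs for which the `i`-th cluster is bad. -/
theorem card_bad_le {K n i : ℕ} (hK : 0 < K) (hn0 : 0 < n) (hn : 2 * K ^ 2 ≤ n) {ε q : ℝ}
    (hε : 0 < ε) (hε1 : ε ≤ 1) (hq : 0 < q) (hnq : 2 * K ≤ q * n)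
    {Adj : Fin n → Fin n → Prop}
    (hAdj : ∀ a b : Fin n, (1 + ε) * n ≤ (#{b' | Adj a b'} : ℝ) + #{a' | Adj a' b})
    (hi : i ∈ Icc 2 (numClustersBip n (K + 1))) :
    (#{π | ¬ ((1 - 2 * q) * (n : ℝ) ^ 2 ≤ numGoodT n (K + 1) ε Adj i π)} : ℝ) ≤
      12 * (K + 1) ^ 2 * Real.exp (-((K + 1) * ε ^ 2 / 8)) / q * (n.factorial : ℝ) ^ 2 := by
  obtain ⟨w, hw, hcl⟩ := bipCluster_eq_image hK hi
  have hn' : (0 : ℝ) < n := by exact_mod_cast hn0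
  set c : ℝ := (1 + ε / 2) * (K + 1) with hc
  set B : ℕ := #{Z : (Fin (K + 1) → Fin n) × (Fin (K + 1) → Fin n) | HasSparsePair Adj c Z.1 Z.2}
    with hB
  have h1 : (#{π | ¬ ((1 - 2 * q) * (n : ℝ) ^ 2 ≤ numGoodT n (K + 1) ε Adj i π)} : ℝ) *
      (q * (n : ℝ) ^ 2) ≤ ((n - K).factorial : ℝ) ^ 2 * B := by
    calc _ = ∑ π with ¬ ((1 - 2 * q) * (n : ℝ) ^ 2 ≤ numGoodT n (K + 1) ε Adj i π),
            q * (n : ℝ) ^ 2 := by rw [Finset.sum_const, nsmul_eq_mul]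
      _ ≤ ∑ π with ¬ ((1 - 2 * q) * (n : ℝ) ^ 2 ≤ numGoodT n (K + 1) ε Adj i π),
            (numSparseExtensions Adj c (π.1.symm ∘ w) (π.2.symm ∘ w) : ℝ) := by
          refine Finset.sum_le_sum fun π hπ => ?_
          have h2 := (Finset.mem_filter.1 hπ).2
          have h : n ^ 2 ≤ numGoodT n (K + 1) ε Adj i π + 2 * K * n +
              numSparseExtensions Adj c (π.1.symm ∘ w) (π.2.symm ∘ w) :=
            sq_le_numGoodT_add (π.1.symm.injective.comp hw) (π.2.symm.injective.comp hw)
              (hcl π.1) (hcl π.2)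
          have h3 : (n : ℝ) ^ 2 ≤ numGoodT n (K + 1) ε Adj i π + 2 * K * n +
              numSparseExtensions Adj c (π.1.symm ∘ w) (π.2.symm ∘ w) := by
            exact_mod_cast h
          nlinarith
      _ ≤ ∑ π : Equiv.Perm (Fin n) × Equiv.Perm (Fin n),
            (numSparseExtensions Adj c (π.1.symm ∘ w) (π.2.symm ∘ w) : ℝ) :=
          Finset.sum_le_sum_of_subset_of_nonneg (Finset.filter_subset _ _)
            fun _ _ _ => Nat.cast_nonneg _
      _ ≤ _ := by
          rw [hB, ← sum_numSparseExtensions]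
          exact_mod_cast sum_perm_prod_comp_le hw (numSparseExtensions Adj c)
  have h2 : (B : ℝ) ≤ ((n : ℝ) ^ (K + 1)) ^ 2 *
      ((K + 1) ^ 2 * (3 * Real.exp (-((K + 1) * ε ^ 2 / 8)))) :=
    card_hasSparsePair_le hn0 hε hε1 hAdj
  have h3 : ((n : ℝ) ^ K * (n - K).factorial) ^ 2 ≤ (2 * (n.factorial : ℝ)) ^ 2 := by
    refine pow_le_pow_left₀ (by positivity) ?_ 2
    exact_mod_cast pow_mul_factorial_sub_le hn hn0
  rw [← mul_le_mul_iff_left₀ (show 0 < q * (n : ℝ) ^ 2 by positivity)]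
  calc _ ≤ ((n - K).factorial : ℝ) ^ 2 * B := h1
    _ ≤ ((n - K).factorial : ℝ) ^ 2 * (((n : ℝ) ^ (K + 1)) ^ 2 *
      ((K + 1) ^ 2 * (3 * Real.exp (-((K + 1) * ε ^ 2 / 8))))) := by gcongr
    _ = ((n : ℝ) ^ K * (n - K).factorial) ^ 2 *
      ((n : ℝ) ^ 2 * ((K + 1) ^ 2 * (3 * Real.exp (-((K + 1) * ε ^ 2 / 8))))) := by ring
    _ ≤ (2 * (n.factorial : ℝ)) ^ 2 *
      ((n : ℝ) ^ 2 * ((K + 1) ^ 2 * (3 * Real.exp (-((K + 1) * ε ^ 2 / 8))))) := by gcongr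
    _ = _ := by
      field_simp
      ring

open Classical in
theorem bip_most_clusters_have_many_assignable_T (ε : ℝ) (hε : 0 < ε) :
    ∃ C₀ : ℕ, ∀ C : ℕ, C₀ ≤ C →
    ∃ n₀ : ℕ, ∀ n : ℕ, n₀ ≤ n →
    ∀ Adj : Fin n → Fin n → Prop,
      (∀ a b : Fin n,
        (1 + ε) * n ≤ ((Finset.univ.filter fun b' => Adj a b').card : ℝ) +
          ((Finset.univ.filter fun a' => Adj a' b).card : ℝ)) →
      (99 : ℝ) / 100 ≤
        permProb n n (fun π =>
          (((Finset.Icc 2 (numClustersBip n C)).filter fun i =>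
              ¬ ((1 - 2 * Real.exp (-((C : ℝ) * ε ^ 2 / 16))) * (n : ℝ) ^ 2 ≤
                  (numGoodT n C ε Adj i π : ℝ))).card : ℝ) ≤
            Real.exp (-((C : ℝ) * ε ^ 2 / 32)) * (numClustersBip n C : ℝ)) := by
  obtain ⟨C₀, hC₀⟩ := exists_forall_sq_mul_exp_le hε
  refine ⟨C₀ + 2, fun C hC => ?_⟩
  obtain ⟨K, rfl⟩ : ∃ K, C = K + 1 := ⟨C - 1, by omega⟩
  have hK : 0 < K := by omega
  set q : ℝ := Real.exp (-(((K + 1 : ℕ) : ℝ) * ε ^ 2 / 16)) with hq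
  have hq0 : 0 < q := Real.exp_pos _
  obtain ⟨n₁, hn₁⟩ := exists_nat_ge (2 * K / q)
  refine ⟨n₁ + 2 * K ^ 2 + 1, fun n hn Adj hAdj => ?_⟩
  have hn0 : 0 < n := by omega
  have hn' : (0 : ℝ) < n := by exact_mod_cast hn0
  have hnq : 2 * K ≤ q * n := by
    rw [mul_comm q, ← div_le_iff₀ hq0]
    exact hn₁.trans (by exact_mod_cast (by omega : n₁ ≤ n))
  have hε1 : ε ≤ 1 := by
    have h := hAdj ⟨0, hn0⟩ ⟨0, hn0⟩
    have hle : ∀ P : Fin n → Prop, ((Finset.univ.filter P).card : ℝ) ≤ n := fun P => by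
      exact_mod_cast (Finset.card_filter_le _ _).trans_eq (by simp)
    have h1 := hle fun b' => Adj ⟨0, hn0⟩ b'
    have h2 := hle fun a' => Adj a' ⟨0, hn0⟩
    have h3 : (1 + ε) * n ≤ 2 * n := by linarith
    linarith [le_of_mul_le_mul_right h3 hn']
  have hbad := fun i hi => card_bad_le (i := i) hK hn0 (by omega) hε hε1 hq0 hnq hAdj hi
  have hm : 0 < numClustersBip n (K + 1) := Nat.succ_pos _
  have hcard : (Finset.Icc 2 (numClustersBip n (K + 1))).card ≤ numClustersBip n (K + 1) := by
    simp
  refine permProb_ge_of_card_bad_le hcard hm (Real.exp_pos _) ?_ (by positivity) hbad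
  have h := hC₀ (K + 1) (by omega)
  rw [div_le_iff₀ hq0]
  set e : ℝ := Real.exp (-(((K + 1 : ℕ) : ℝ) * ε ^ 2 / 32)) with he
  have h1 : q = e ^ 2 := by
    rw [hq, he, ← Real.exp_nat_mul]; congr 1; push_cast; ring
  have h2 : Real.exp (-((K + 1) * ε ^ 2 / 8)) = e ^ 4 := by
    rw [he, ← Real.exp_nat_mul]; congr 1; push_cast; ring
  rw [h1, h2]
  have he0 : 0 < e := Real.exp_pos _
  push_cast at h
  have := mul_le_mul_of_nonneg_right h (pow_pos he0 3).le
  nlinarith
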